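/- Let f : [0,1] → ℝ be Riemann integrable. Then the set { x ∈ (0,1) : lim_{n→∞} B_n(f, x) exists and equals f(x) } has Lebesgue measure 1. -/

import Mathlib

open Filter Set MeasureTheory

/-- The n-th Bernstein polynomial of `f` evaluated at `x`. -/
noncomputable def bern (f : ℝ → ℝ) (n : ℕ) (x : ℝ) : ℝ :=
  ∑ k ∈ Finset.range (n + 1),
    f ((k : ℝ) / (n : ℝ)) * (n.choose k : ℝ) * x ^ k * (1 - x) ^ (n - k)

/-- Riemann sum of `f` for the tagged partition given by points `x 0, …, x m` and tags `t`. -/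
noncomputable def riemannSum (f : ℝ → ℝ) (m : ℕ) (x t : ℕ → ℝ) : ℝ :=
  ∑ i ∈ Finset.range m, f (t i) * (x (i + 1) - x i)

/-- `f` is Riemann integrable on `[0,1]` with integral `I`. -/
def RiemannIntegrableTo (f : ℝ → ℝ) (I : ℝ) : Prop :=
  ∀ ε > (0:ℝ), ∃ δ > (0:ℝ), ∀ (m : ℕ) (x t : ℕ → ℝ),
    x 0 = 0 → x m = 1 →
    (∀ i < m, x i ≤ t i ∧ t i ≤ x (i + 1)) →
    (∀ i < m, x (i + 1) - x i < δ) →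
    |riemannSum f m x t - I| < ε

/-- `f` is Riemann integrable on `[0,1]`. -/
def RiemannIntegrable (f : ℝ → ℝ) : Prop :=
  ∃ I : ℝ, RiemannIntegrableTo f I

/-- For a Riemann integrable function, changing the tags of a sufficiently fine uniform
partition changes the Riemann sum arbitrarily little. -/
theorem RiemannIntegrable.exists_uniform_partition {f : ℝ → ℝ} (hf : RiemannIntegrable f)
    {ε : ℝ} (hε : 0 < ε) :
    ∃ m : ℕ, 0 < m ∧ ∀ s t : ℕ → ℝ,
      (∀ i < m, s i ∈ Icc ((i : ℝ) / m) (((i + 1 : ℕ) : ℝ) / m)) →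
      (∀ i < m, t i ∈ Icc ((i : ℝ) / m) (((i + 1 : ℕ) : ℝ) / m)) →
      |∑ i ∈ Finset.range m, (f (s i) - f (t i))| < ε * m := by
  obtain ⟨I, hI⟩ := hf
  obtain ⟨δ, hδ, h⟩ := hI (ε / 2) (half_pos hε)
  obtain ⟨k, hk⟩ := exists_nat_one_div_lt hδ
  have hm : (0 : ℝ) < ((k + 1 : ℕ) : ℝ) := by positivity
  refine ⟨k + 1, k.succ_pos, fun s t hs ht => ?_⟩
  rw [← Nat.cast_add_one] at hk
  generalize k + 1 = m at *
  have hwidth : ∀ i : ℕ, ((i + 1 : ℕ) : ℝ) / m - (i : ℝ) / m = 1 / m := by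
    intro i
    push_cast
    ring
  have hsum : ∀ t : ℕ → ℝ, riemannSum f m (fun i => (i : ℝ) / m) t
      = (∑ i ∈ Finset.range m, f (t i)) / m := by
    intro t
    simp only [riemannSum, hwidth, Finset.sum_div, mul_one_div]
  have hclose : ∀ t : ℕ → ℝ,
      (∀ i < m, t i ∈ Icc ((i : ℝ) / m) (((i + 1 : ℕ) : ℝ) / m)) →
      |(∑ i ∈ Finset.range m, f (t i)) / m - I| < ε / 2 := by
    intro t ht
    rw [← hsum]
    refine h m _ t (by simp) (div_self hm.ne') ht fun i _ => ?_
    simp only [hwidth]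
    exact hk
  have h1 := abs_lt.1 (hclose s hs)
  have h2 := abs_lt.1 (hclose t ht)
  have h3 : |(∑ i ∈ Finset.range m, (f (s i) - f (t i))) / m| < ε := by
    rw [Finset.sum_sub_distrib, sub_div, abs_lt]
    constructor <;> linarith
  rwa [abs_div, abs_of_pos hm, div_lt_iff₀ hm] at h3

/-- Every point of `[0, 1)` lies in a cell of the uniform partition. -/
theorem exists_mem_uniform_cell {m : ℕ} (hm : 0 < m) {x : ℝ} (h0 : 0 ≤ x) (h1 : x < 1) :
    ∃ i < m, x ∈ Ico ((i : ℝ) / m) (((i + 1 : ℕ) : ℝ) / m) := by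
  have hm' : (0 : ℝ) < m := by exact_mod_cast hm
  refine ⟨⌊x * m⌋₊, ?_, ?_, ?_⟩
  · rw [Nat.floor_lt (by positivity)]
    nlinarith
  · rw [div_le_iff₀ hm']
    exact Nat.floor_le (by positivity)
  · rw [lt_div_iff₀ hm']
    push_cast
    exact Nat.lt_floor_add_one _

theorem left_mem_uniform_cell (m i : ℕ) :
    (i : ℝ) / m ∈ Icc ((i : ℝ) / m) (((i + 1 : ℕ) : ℝ) / m) :=
  ⟨le_rfl, by gcongr; simp⟩

theorem RiemannIntegrable.exists_bound {f : ℝ → ℝ} (hf : RiemannIntegrable f) :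
    ∃ M, ∀ x ∈ Icc (0 : ℝ) 1, |f x| ≤ M := by
  obtain ⟨m, hm, h⟩ := hf.exists_uniform_partition one_pos
  refine ⟨m + ∑ j ∈ Finset.range m, |f ((j : ℝ) / m)| + |f 1|, fun x hx => ?_⟩
  have hnonneg : 0 ≤ ∑ j ∈ Finset.range m, |f ((j : ℝ) / m)| :=
    Finset.sum_nonneg fun _ _ => abs_nonneg _
  rcases hx.2.eq_or_lt with rfl | hx1
  · have : (0 : ℝ) ≤ m := m.cast_nonneg
    linarith
  obtain ⟨i, hi, hxi⟩ := exists_mem_uniform_cell hm hx.1 hx1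
  have hdiff := h (Function.update (fun j => (j : ℝ) / m) i x) (fun j => (j : ℝ) / m)
    (fun j _ => by
      rcases eq_or_ne j i with rfl | hj
      · simpa using ⟨hxi.1, by simpa using hxi.2.le⟩
      · simpa [hj] using left_mem_uniform_cell m j)
    (fun j _ => left_mem_uniform_cell m j)
  rw [Finset.sum_eq_single_of_mem i (Finset.mem_range.2 hi) (fun j _ hj => by simp [hj])] at hdiff
  simp only [Function.update_self, one_mul] at hdiff
  have hle := Finset.single_le_sum (f := fun j : ℕ => |f ((j : ℝ) / m)|)
    (fun _ _ => abs_nonneg _) (Finset.mem_range.2 hi)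
  have htri := abs_sub_abs_le_abs_sub (f x) (f ((i : ℝ) / m))
  have := abs_nonneg (f 1)
  linarith

/-- The points near which a Riemann integrable function keeps deviating by at least `η`
form a null subset of `(0, 1)`. -/
theorem RiemannIntegrable.volume_large_deviation {f : ℝ → ℝ} (hf : RiemannIntegrable f)
    {η : ℝ} (hη : 0 < η) :
    volume {x ∈ Ioo (0 : ℝ) 1 | ∀ r > 0, ∃ y, |y - x| < r ∧ η ≤ |f y - f x|} = 0 := by
  classical
  set D := {x ∈ Ioo (0 : ℝ) 1 | ∀ r > 0, ∃ y, |y - x| < r ∧ η ≤ |f y - f x|}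
  refine le_antisymm (ENNReal.le_of_forall_pos_le_add fun ε hε _ => ?_) zero_le
  rw [zero_add]
  have hε' : (0 : ℝ) < ε := hε
  obtain ⟨m, hm, h⟩ := hf.exists_uniform_partition (mul_pos hη hε')
  have hm' : (0 : ℝ) < m := by exact_mod_cast hm
  let cell : ℕ → Set ℝ := fun i => Ioo ((i : ℝ) / m) (((i + 1 : ℕ) : ℝ) / m)
  let bad : Finset ℕ := (Finset.range m).filter fun i => (D ∩ cell i).Nonempty
  have htags : ∀ i : ℕ, ∃ p : ℝ × ℝ,
      p.1 ∈ Icc ((i : ℝ) / m) (((i + 1 : ℕ) : ℝ) / m) ∧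
      p.2 ∈ Icc ((i : ℝ) / m) (((i + 1 : ℕ) : ℝ) / m) ∧
      (if (D ∩ cell i).Nonempty then η else 0) ≤ f p.1 - f p.2 := by
    intro i
    split_ifs with hi
    · obtain ⟨x, hxD, hxi⟩ := hi
      obtain ⟨r, hr, hball⟩ := Metric.isOpen_iff.1 isOpen_Ioo x hxi
      obtain ⟨y, hyr, hy⟩ := hxD.2 r hr
      have hyi := hball (show y ∈ Metric.ball x r from by rwa [Metric.mem_ball, Real.dist_eq])
      rcases le_abs.1 hy with hy | hy
      · exact ⟨(y, x), Ioo_subset_Icc_self hyi, Ioo_subset_Icc_self hxi, hy⟩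
      · exact ⟨(x, y), Ioo_subset_Icc_self hxi, Ioo_subset_Icc_self hyi, by simpa using hy⟩
    · exact ⟨((i : ℝ) / m, (i : ℝ) / m), left_mem_uniform_cell m i, left_mem_uniform_cell m i,
        by simp⟩
  choose p hp1 hp2 hp3 using htags
  have hcard : (bad.card : ℝ) * η < η * ε * m := by
    calc (bad.card : ℝ) * η
        = ∑ i ∈ Finset.range m, if (D ∩ cell i).Nonempty then η else 0 := by
          rw [← Finset.sum_filter, Finset.sum_const, nsmul_eq_mul]
      _ ≤ ∑ i ∈ Finset.range m, (f (p i).1 - f (p i).2) := Finset.sum_le_sum fun i _ => hp3 i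
      _ ≤ |∑ i ∈ Finset.range m, (f (p i).1 - f (p i).2)| := le_abs_self _
      _ < η * ε * m := h (fun i => (p i).1) (fun i => (p i).2)
          (fun i _ => hp1 i) (fun i _ => hp2 i)
  have hcover : D ⊆ range (fun i : ℕ => (i : ℝ) / m) ∪ ⋃ i ∈ bad, cell i := by
    intro x hx
    obtain ⟨i, hi, hxi⟩ := exists_mem_uniform_cell hm hx.1.1.le hx.1.2
    rcases hxi.1.eq_or_lt with heq | hlt
    · exact Or.inl ⟨i, heq⟩
    · have hxc : x ∈ cell i := ⟨hlt, hxi.2⟩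
      exact Or.inr (mem_biUnion
        (Finset.mem_coe.2 (Finset.mem_filter.2 ⟨Finset.mem_range.2 hi, x, hx, hxc⟩)) hxc)
  have hcell : ∀ i, volume (cell i) = ENNReal.ofReal (1 / m) := by
    intro i
    simp only [cell, Real.volume_Ioo]
    congr 1
    push_cast
    ring
  calc volume D
      ≤ volume (range fun i : ℕ => (i : ℝ) / m) + volume (⋃ i ∈ bad, cell i) :=
        (measure_mono hcover).trans (measure_union_le _ _)
    _ ≤ 0 + ∑ i ∈ bad, volume (cell i) := by
        gcongr
        · exact ((countable_range _).measure_zero _).le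
        · exact measure_biUnion_finset_le _ _
    _ = ENNReal.ofReal (bad.card * (1 / m)) := by
        simp only [hcell, Finset.sum_const, zero_add, nsmul_eq_mul]
        rw [ENNReal.ofReal_mul (by positivity), ENNReal.ofReal_natCast]
    _ ≤ ε := by
        rw [ENNReal.ofReal_le_coe, mul_one_div, div_le_iff₀ hm']
        nlinarith

theorem RiemannIntegrable.volume_not_continuousAt {f : ℝ → ℝ} (hf : RiemannIntegrable f) :
    volume {x ∈ Ioo (0 : ℝ) 1 | ¬ ContinuousAt f x} = 0 := by
  refine measure_mono_null ?_ (measure_iUnion_null fun k : ℕ =>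
    hf.volume_large_deviation (Nat.one_div_pos_of_nat (α := ℝ) (n := k)))
  rintro x ⟨hx, hcont⟩
  simp only [Metric.continuousAt_iff, Real.dist_eq] at hcont
  push Not at hcont
  obtain ⟨η, hη, hdev⟩ := hcont
  obtain ⟨k, hk⟩ := exists_nat_one_div_lt hη
  refine mem_iUnion.2 ⟨k, hx, fun r hr => ?_⟩
  obtain ⟨y, hyr, hy⟩ := hdev r hr
  exact ⟨y, hyr, hk.le.trans hy⟩

theorem bern_eq_sum_bernstein (f : ℝ → ℝ) (n : ℕ) (x : unitInterval) :
    bern f n x = ∑ k : Fin (n + 1), f ((k : ℝ) / n) * bernstein n k x := by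
  rw [bern, Finset.sum_range]
  simp only [bernstein_apply, mul_assoc]

/-- Bernstein polynomials of a bounded function converge at its continuity points. -/
theorem tendsto_bern_of_continuousAt {f : ℝ → ℝ} {M : ℝ}
    (hM : ∀ x ∈ Icc (0 : ℝ) 1, |f x| ≤ M) (x : unitInterval) (hx : ContinuousAt f x) :
    Tendsto (fun n => bern f n x) atTop (nhds (f x)) := by
  rw [Metric.tendsto_atTop]
  intro ε hε
  obtain ⟨δ, hδ, hclose⟩ := Metric.continuousAt_iff.1 hx (ε / 2) (half_pos hε)
  simp only [Real.dist_eq] at hclose ⊢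
  have hM0 : 0 ≤ M := (abs_nonneg _).trans (hM x x.2)
  set C : ℝ := 2 * M / δ ^ 2 with hC
  have hC0 : 0 ≤ C := by positivity
  have hbound : ∀ n : ℕ, 0 < n → |bern f n x - f x| ≤ ε / 2 + C / n := by
    intro n hn
    have hn' : (0 : ℝ) < n := by exact_mod_cast hn
    have hterm : ∀ k : Fin (n + 1),
        |f ((k : ℝ) / n) - f x| ≤ ε / 2 + C * ((x : ℝ) - (k : ℝ) / n) ^ 2 := by
      intro k
      rcases lt_or_ge |(k : ℝ) / n - x| δ with hk | hk
      · have := (hclose hk).le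
        have : 0 ≤ C * ((x : ℝ) - (k : ℝ) / n) ^ 2 := by positivity
        linarith
      · have hkI : (k : ℝ) / n ∈ Icc (0 : ℝ) 1 := by
          refine ⟨by positivity, (div_le_one hn').2 ?_⟩
          exact_mod_cast Nat.lt_succ_iff.1 k.2
        have h2M : |f ((k : ℝ) / n) - f x| ≤ 2 * M := by
          have := abs_sub (f ((k : ℝ) / n)) (f x)
          linarith [hM _ hkI, hM x x.2]
        have hsq : δ ^ 2 ≤ ((x : ℝ) - (k : ℝ) / n) ^ 2 := by
          rw [← sq_abs ((x : ℝ) - (k : ℝ) / n), abs_sub_comm]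
          gcongr
        have : 2 * M ≤ C * ((x : ℝ) - (k : ℝ) / n) ^ 2 := by
          calc 2 * M = C * δ ^ 2 := by rw [hC]; field_simp
            _ ≤ _ := by gcongr
        linarith
    have hprob := bernstein.probability n x
    have hvar : ∑ k : Fin (n + 1), ((x : ℝ) - (k : ℝ) / n) ^ 2 * bernstein n k x
        = (x : ℝ) * (1 - x) / n := bernstein.variance hn.ne' x
    calc |bern f n x - f x|
        = |∑ k : Fin (n + 1), (f ((k : ℝ) / n) - f x) * bernstein n k x| := by
          simp only [bern_eq_sum_bernstein, sub_mul, Finset.sum_sub_distrib, ← Finset.mul_sum,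
            hprob, mul_one]
      _ ≤ ∑ k : Fin (n + 1), |f ((k : ℝ) / n) - f x| * bernstein n k x := by
          refine (Finset.abs_sum_le_sum_abs _ _).trans_eq ?_
          simp only [abs_mul, abs_of_nonneg bernstein_nonneg]
      _ ≤ ∑ k : Fin (n + 1), (ε / 2 + C * ((x : ℝ) - (k : ℝ) / n) ^ 2) * bernstein n k x :=
          Finset.sum_le_sum fun k _ => mul_le_mul_of_nonneg_right (hterm k) bernstein_nonneg
      _ = ε / 2 + C * ((x : ℝ) * (1 - x) / n) := by
          simp only [add_mul, Finset.sum_add_distrib, mul_assoc, ← Finset.mul_sum, hprob, hvar,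
            mul_one]
      _ ≤ ε / 2 + C / n := by
          rw [← mul_div_assoc]
          gcongr
          have h0 := x.2.1
          have h1 := x.2.2
          exact mul_le_of_le_one_right hC0 (by nlinarith)
  have hlim : Tendsto (fun n : ℕ => C / (n : ℝ)) atTop (nhds 0) :=
    tendsto_const_div_atTop_nhds_zero_nat C
  obtain ⟨N, hN⟩ := eventually_atTop.1
    ((hlim.eventually_lt_const (half_pos hε)).and (eventually_gt_atTop 0))
  exact ⟨N, fun n hn => (hbound n (hN n hn).2).trans_lt (by linarith [(hN n hn).1])⟩

theorem stmt17 (f : ℝ → ℝ) (hf : RiemannIntegrable f) :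
    volume {x ∈ Set.Ioo (0:ℝ) 1 |
      Filter.Tendsto (fun n => bern f n x) Filter.atTop (nhds (f x))} = 1 := by
  obtain ⟨M, hM⟩ := hf.exists_bound
  have hvol : volume (Ioo (0 : ℝ) 1) = 1 := by simp
  refine le_antisymm ((measure_mono (sep_subset _ _)).trans_eq hvol) ?_
  rw [← hvol, ← measure_sdiff_null hf.volume_not_continuousAt]
  refine measure_mono fun x hx => ⟨hx.1, ?_⟩
  refine tendsto_bern_of_continuousAt hM ⟨x, Ioo_subset_Icc_self hx.1⟩ ?_
  by_contra hcont
  exact hx.2 ⟨hx.1, hcont⟩
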